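/- arXiv:1405.6310 — 3 statements merged into one kernel-verified Lean document; each statement's English description precedes it below -/
import Mathlib

section
/- Let G be a torsion-free co-hopfian hyperbolic group with finite generating set A, let d ∈ V^A(p,γ,T) be a visual metric on G, and let φ be an endomorphism of G with Gφ ≠ {1}. Then the following are equivalent: (i) φ is uniformly continuous as a map from (G,d) to (G,d); (ii) φ satisfies a Hölder condition with respect to d; (iii) the kernel of φ is finite; (iv) φ is an automorphism of G. -/
open scoped Classical

section Defs

variable {G : Type*}

/-- Word length of `g` with respect to a generating set `A`: the least `n` such that
`g` is a product of `n` elements of `A ∪ A⁻¹`. -/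
noncomputable def wordLength [Group G] (A : Set G) (g : G) : ℕ :=
  sInf {n : ℕ | ∃ w : List G, w.length = n ∧ (∀ x ∈ w, x ∈ A ∨ x⁻¹ ∈ A) ∧ w.prod = g}

/-- The word metric `d_A(g,h)` (as a real number). -/
noncomputable def wordDist [Group G] (A : Set G) (g h : G) : ℝ :=
  (wordLength A (g⁻¹ * h) : ℝ)

/-- The Gromov product `(x|y)_p` with respect to a distance function `d`. -/
noncomputable def gromov {X : Type*} (d : X → X → ℝ) (p x y : X) : ℝ :=
  (d p x + d p y - d x y) / 2

/-- `G` is `δ`-hyperbolic with respect to the generating set `A`. -/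
def IsHyperbolicWith [Group G] (A : Set G) (δ : ℝ) : Prop :=
  ∀ p g₀ g₁ g₂ : G,
    min (gromov (wordDist A) p g₀ g₁) (gromov (wordDist A) p g₁ g₂) - δ ≤
      gromov (wordDist A) p g₀ g₂

/-- `G` is hyperbolic with respect to the generating set `A`. -/
def IsHyperbolic [Group G] (A : Set G) : Prop :=
  ∃ δ : ℝ, 0 ≤ δ ∧ IsHyperbolicWith A δ

/-- `ρ_{p,γ}(g,h) = e^{-γ (g|h)_p}` (and `0` on the diagonal), with respect to a
distance function `dA`. -/
noncomputable def visualRhoOf {X : Type*} (dA : X → X → ℝ) (p : X) (γ : ℝ) (g h : X) : ℝ :=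
  if g = h then 0 else Real.exp (-γ * gromov dA p g h)

/-- `d` is a metric on `X`. -/
structure IsMetric {X : Type*} (d : X → X → ℝ) : Prop where
  refl : ∀ x, d x x = 0
  eq_of : ∀ x y, d x y = 0 → x = y
  symm : ∀ x y, d x y = d y x
  triangle : ∀ x y z, d x z ≤ d x y + d y z

/-- `d` is a visual metric in `V(p,γ,T)` with respect to the distance function `dA`. -/
def InVisualOf {X : Type*} (dA : X → X → ℝ) (p : X) (γ T : ℝ) (d : X → X → ℝ) : Prop :=
  IsMetric d ∧ ∀ g h : X, g ≠ h →
    visualRhoOf dA p γ g h / T ≤ d g h ∧ d g h ≤ T * visualRhoOf dA p γ g h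

/-- `d ∈ V^A(p,γ,T)`: `d` is a visual metric with respect to the word metric `d_A`. -/
def InVisual [Group G] (A : Set G) (p : G) (γ T : ℝ) (d : G → G → ℝ) : Prop :=
  InVisualOf (wordDist A) p γ T d

/-- `φ : (X,d) → (X,d')` satisfies a Hölder condition of exponent `r`. -/
def HolderCondWith {X : Type*} (d d' : X → X → ℝ) (φ : X → X) (r : ℝ) : Prop :=
  ∃ K : ℝ, 0 < K ∧ ∀ g h : X, d' (φ g) (φ h) ≤ K * d g h ^ r

/-- `φ : (X,d) → (X,d')` satisfies a Hölder condition (of some positive exponent). -/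
def SatisfiesHolder {X : Type*} (d d' : X → X → ℝ) (φ : X → X) : Prop :=
  ∃ r : ℝ, 0 < r ∧ HolderCondWith d d' φ r

/-- `φ : (X,d) → (X,d')` satisfies a Lipschitz condition. -/
def LipschitzCond {X : Type*} (d d' : X → X → ℝ) (φ : X → X) : Prop :=
  ∃ K : ℝ, 0 < K ∧ ∀ g h : X, d' (φ g) (φ h) ≤ K * d g h

/-- `φ : (X,d) → (X,d')` is uniformly continuous. -/
def UnifCont {X : Type*} (d d' : X → X → ℝ) (φ : X → X) : Prop :=
  ∀ ε : ℝ, 0 < ε → ∃ δ : ℝ, 0 < δ ∧ ∀ g h : X, d g h < δ → d' (φ g) (φ h) < ε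

/-- `φ : (X,d) → (X,d')` is a quasi-isometric embedding. -/
def QIEmbedding {X : Type*} (d d' : X → X → ℝ) (φ : X → X) : Prop :=
  ∃ lam K : ℝ, 1 ≤ lam ∧ 0 ≤ K ∧ ∀ g h : X,
    (1 / lam) * d g h - K ≤ d' (φ g) (φ h) ∧ d' (φ g) (φ h) ≤ lam * d g h + K

/-- `H` is a quasiconvex subset of `G` with respect to the generating set `A`:
every geodesic word-metric chain joining two points of `H` stays at bounded
distance from `H`. -/
def IsQuasiconvex [Group G] (A : Set G) (H : Set G) : Prop :=
  ∃ q : ℝ, 0 ≤ q ∧ ∀ h ∈ H, ∀ h' ∈ H, ∀ n : ℕ, ∀ g : ℕ → G,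
    g 0 = h → g n = h' → (n : ℝ) = wordDist A h h' →
    (∀ i < n, wordDist A (g i) (g (i + 1)) = 1) →
    ∀ i ≤ n, ∃ z ∈ H, wordDist A (g i) z ≤ q

end Defs

section WordLength

variable {G : Type*} [Group G] {A : Set G}

theorem wordLength_list_prod_le {w : List G} (hw : ∀ x ∈ w, x ∈ A ∨ x⁻¹ ∈ A) :
    wordLength A w.prod ≤ w.length :=
  Nat.sInf_le ⟨w, rfl, hw, rfl⟩

theorem exists_list_wordLength (hA : Subgroup.closure A = ⊤) (g : G) :
    ∃ w : List G, w.length = wordLength A g ∧ (∀ x ∈ w, x ∈ A ∨ x⁻¹ ∈ A) ∧ w.prod = g := by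
  have hg : g ∈ (Subgroup.closure A).toSubmonoid := hA ▸ Subgroup.mem_top g
  rw [Subgroup.closure_toSubmonoid] at hg
  obtain ⟨w, hw, hprod⟩ := Submonoid.exists_list_of_mem_closure hg
  exact Nat.sInf_mem
    (s := {n : ℕ | ∃ w : List G, w.length = n ∧ (∀ x ∈ w, x ∈ A ∨ x⁻¹ ∈ A) ∧ w.prod = g})
    ⟨w.length, w, rfl, hw, hprod⟩

@[simp]
theorem wordLength_one : wordLength A (1 : G) = 0 := by
  simpa using wordLength_list_prod_le (A := A) (w := []) (by simp)

theorem wordLength_mul_le (hA : Subgroup.closure A = ⊤) (g h : G) :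
    wordLength A (g * h) ≤ wordLength A g + wordLength A h := by
  obtain ⟨u, hu, huA, rfl⟩ := exists_list_wordLength hA g
  obtain ⟨v, hv, hvA, rfl⟩ := exists_list_wordLength hA h
  rw [← hu, ← hv, ← List.prod_append, ← List.length_append]
  refine wordLength_list_prod_le fun x hx => ?_
  rcases List.mem_append.1 hx with hx | hx
  exacts [huA x hx, hvA x hx]

theorem wordLength_inv_le (hA : Subgroup.closure A = ⊤) (g : G) :
    wordLength A g⁻¹ ≤ wordLength A g := by
  obtain ⟨u, hu, huA, rfl⟩ := exists_list_wordLength hA g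
  rw [← hu, List.prod_inv_reverse]
  refine (wordLength_list_prod_le fun x hx => ?_).trans_eq (by simp)
  simp only [List.mem_reverse, List.mem_map] at hx
  obtain ⟨y, hy, rfl⟩ := hx
  simpa using (huA y hy).symm

theorem wordLength_inv (hA : Subgroup.closure A = ⊤) (g : G) :
    wordLength A g⁻¹ = wordLength A g :=
  (wordLength_inv_le hA g).antisymm (by simpa using wordLength_inv_le hA g⁻¹)

theorem exists_mul_eq_wordLength (hA : Subgroup.closure A = ⊤) (g : G) {j : ℕ}
    (hj : j ≤ wordLength A g) :
    ∃ a b : G, a * b = g ∧ wordLength A a = j ∧ wordLength A a + wordLength A b = wordLength A g := by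
  obtain ⟨w, hw, hwA, rfl⟩ := exists_list_wordLength hA g
  have h₁ := wordLength_list_prod_le (w := w.take j) fun x hx => hwA x (List.mem_of_mem_take hx)
  have h₂ := wordLength_list_prod_le (w := w.drop j) fun x hx => hwA x (List.mem_of_mem_drop hx)
  have h₃ := wordLength_mul_le hA (w.take j).prod (w.drop j).prod
  have h₄ := List.prod_take_mul_prod_drop w j
  rw [h₄] at h₃
  rw [List.length_take] at h₁
  rw [List.length_drop] at h₂
  exact ⟨_, _, h₄, by omega, by omega⟩

theorem finite_setOf_wordLength_le (hA : Subgroup.closure A = ⊤) (hfin : A.Finite) (n : ℕ) :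
    {g : G | wordLength A g ≤ n}.Finite := by
  have hB : (A ∪ A⁻¹).Finite := hfin.union hfin.inv
  have := hB.to_subtype
  refine ((List.finite_length_le (A ∪ A⁻¹ : Set G) n).image
    fun l => (l.map Subtype.val).prod).subset fun g hg => ?_
  obtain ⟨w, hw, hwA, rfl⟩ := exists_list_wordLength hA g
  lift w to List (A ∪ A⁻¹ : Set G) using fun x hx => by simpa using hwA x hx
  rw [List.length_map] at hw
  exact ⟨w, hw.trans_le hg, rfl⟩

theorem exists_wordLength_map_le (hA : Subgroup.closure A = ⊤) (hfin : A.Finite) (φ : G →* G) :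
    ∃ L : ℕ, ∀ g, wordLength A (φ g) ≤ L * wordLength A g := by
  obtain ⟨L, hL⟩ := (hfin.image fun a => wordLength A (φ a)).bddAbove
  have hL' : ∀ x, x ∈ A ∨ x⁻¹ ∈ A → wordLength A (φ x) ≤ L := by
    rintro x (hx | hx)
    · exact hL ⟨x, hx, rfl⟩
    · rw [← wordLength_inv hA, ← map_inv]
      exact hL ⟨_, hx, rfl⟩
  refine ⟨L, fun g => ?_⟩
  obtain ⟨w, hw, hwA, rfl⟩ := exists_list_wordLength hA g
  rw [← hw]
  clear hw
  induction w with
  | nil => simp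
  | cons x w ih =>
    have h₁ := ih fun y hy => hwA y (List.mem_cons_of_mem x hy)
    have h₂ := hL' x (hwA x List.mem_cons_self)
    have h₃ := wordLength_mul_le hA (φ x) (φ w.prod)
    rw [List.prod_cons, map_mul, List.length_cons, mul_add, mul_one]
    omega

theorem wordDist_one_left (g : G) : wordDist A 1 g = wordLength A g := by
  simp [wordDist]

theorem wordDist_comm (hA : Subgroup.closure A = ⊤) (g h : G) :
    wordDist A g h = wordDist A h g := by
  rw [wordDist, wordDist, ← wordLength_inv hA]
  simp

theorem wordDist_triangle (hA : Subgroup.closure A = ⊤) (g h k : G) :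
    wordDist A g k ≤ wordDist A g h + wordDist A h k := by
  have := wordLength_mul_le hA (g⁻¹ * h) (h⁻¹ * k)
  rw [show g⁻¹ * h * (h⁻¹ * k) = g⁻¹ * k by group] at this
  unfold wordDist
  exact_mod_cast this

theorem wordDist_mul_right (g h : G) : wordDist A g (g * h) = wordLength A h := by
  simp [wordDist]

/-- Changing the basepoint changes the Gromov product by at most the distance moved. -/
theorem gromov_wordDist_le_add (hA : Subgroup.closure A = ⊤) (p q x y : G) :
    gromov (wordDist A) p x y ≤ gromov (wordDist A) q x y + wordDist A p q := by
  have h₁ := wordDist_triangle hA p q x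
  have h₂ := wordDist_triangle hA p q y
  unfold gromov
  linarith

theorem sub_wordDist_le_gromov (hA : Subgroup.closure A = ⊤) (p x y : G) :
    wordDist A p x - wordDist A x y ≤ gromov (wordDist A) p x y := by
  have := wordDist_triangle hA p y x
  rw [wordDist_comm hA y x] at this
  unfold gromov
  linarith

end WordLength

section QuasiIsometry

variable {G : Type*} [Group G] {A : Set G}

theorem IsHyperbolicWith.sub_le_gromov {δ : ℝ} (h : IsHyperbolicWith A δ) {p x y z : G} {c : ℝ}
    (hxy : c ≤ gromov (wordDist A) p x y) (hyz : c ≤ gromov (wordDist A) p y z) :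
    c - δ ≤ gromov (wordDist A) p x z :=
  (sub_le_sub_right (le_min hxy hyz) δ).trans (h p x y z)

/-- Along a geodesic issuing from `1`, the images under a bi-Lipschitz endomorphism have Gromov
products growing at least linearly. -/
theorem gromov_map_ge_of_geodesic (hA : Subgroup.closure A = ⊤) {δ : ℝ} (hδ : 0 ≤ δ)
    (hhyp : IsHyperbolicWith A δ) (φ : G →* G) {L : ℝ} (hL : 0 < L)
    (hub : ∀ g, (wordLength A (φ g) : ℝ) ≤ L * wordLength A g)
    (hlb : ∀ g, (wordLength A g : ℝ) / L ≤ wordLength A (φ g)) {N : ℕ} (hN : 0 < N)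
    (hNL : L * δ ≤ N) (n : ℕ) :
    ∀ z u : G, wordLength A u = n → wordLength A (z * u) = wordLength A z + wordLength A u →
      (wordLength A z : ℝ) / L - (L * N + δ) ≤
        gromov (wordDist A) 1 (φ z) (φ (z * u)) := by
  have hclose : ∀ z u : G, wordLength A u ≤ N →
      (wordLength A z : ℝ) / L - L * N ≤ gromov (wordDist A) 1 (φ z) (φ (z * u)) := by
    intro z u hu
    have h := sub_wordDist_le_gromov hA 1 (φ z) (φ (z * u))
    rw [map_mul, wordDist_mul_right, wordDist_one_left] at h
    have h₁ : L * wordLength A u ≤ L * N := by gcongr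
    have h₂ := hub u
    have h₃ := hlb z
    rw [map_mul]
    linarith
  induction n using Nat.strong_induction_on with
  | _ n ih =>
    intro z u hu hzu
    by_cases hle : wordLength A u ≤ N
    · linarith [hclose z u hle]
    obtain ⟨a, b, rfl, ha, hab⟩ := exists_mul_eq_wordLength hA u (le_of_not_ge hle)
    have hza := wordLength_mul_le hA z a
    have hzab := wordLength_mul_le hA (z * a) b
    rw [← mul_assoc] at hzu
    have h₁ := ih (wordLength A b) (by omega) (z * a) b rfl (by omega)
    have h₂ := hclose z a ha.le
    have h₄ : (wordLength A (z * a) : ℝ) = wordLength A z + N := by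
      have : wordLength A (z * a) = wordLength A z + N := by omega
      exact_mod_cast this
    have h₅ : δ ≤ N / L := (le_div_iff₀ hL).2 (by linarith)
    rw [h₄, add_div] at h₁
    have h₃ := hhyp.sub_le_gromov h₂ ((show _ ≤ _ by linarith).trans h₁)
    rw [← mul_assoc]
    linarith

/-- A bi-Lipschitz endomorphism of a hyperbolic group distorts Gromov products at most linearly. -/
theorem exists_gromov_map_ge (hA : Subgroup.closure A = ⊤) {δ : ℝ} (hδ : 0 ≤ δ)
    (hhyp : IsHyperbolicWith A δ) (φ : G →* G) {L : ℝ} (hL : 0 < L)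
    (hub : ∀ g, (wordLength A (φ g) : ℝ) ≤ L * wordLength A g)
    (hlb : ∀ g, (wordLength A g : ℝ) / L ≤ wordLength A (φ g)) :
    ∃ C : ℝ, ∀ g h : G,
      gromov (wordDist A) 1 g h / L - C ≤ gromov (wordDist A) 1 (φ g) (φ h) := by
  obtain ⟨N, hN⟩ := exists_nat_ge (L * δ)
  have hgeo := gromov_map_ge_of_geodesic hA hδ hhyp φ hL hub hlb N.succ_pos
    (hN.trans (by push_cast; linarith))
  set D : ℝ := L * (N.succ : ℕ) + δ
  have hD : 0 ≤ D := by positivity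
  have hsymm : ∀ x y : G, gromov (wordDist A) 1 x y = gromov (wordDist A) 1 y x := fun x y => by
    rw [gromov, gromov, wordDist_comm hA x y, add_comm (wordDist A 1 x)]
  refine ⟨1 / L + D + L * (4 * δ) + 2 * δ, fun g h => ?_⟩
  have hnonneg : 0 ≤ gromov (wordDist A) 1 g h := by
    have := wordDist_triangle hA g 1 h
    rw [wordDist_comm hA g 1] at this
    unfold gromov
    linarith
  have hleg : gromov (wordDist A) 1 g h ≤ wordLength A g := by
    have := wordDist_triangle hA 1 g h
    rw [← wordDist_one_left]
    unfold gromov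
    linarith
  have hleh : gromov (wordDist A) 1 g h ≤ wordLength A h := by
    have := wordDist_triangle hA 1 h g
    rw [wordDist_comm hA h g] at this
    rw [← wordDist_one_left]
    unfold gromov
    linarith
  set m := ⌊gromov (wordDist A) 1 g h⌋₊
  have hm : (m : ℝ) ≤ gromov (wordDist A) 1 g h := Nat.floor_le hnonneg
  have hm' : gromov (wordDist A) 1 g h < m + 1 := Nat.lt_floor_add_one _
  obtain ⟨z, a, rfl, hz, hza⟩ := exists_mul_eq_wordLength hA g (j := m)
    (by exact_mod_cast hm.trans hleg)
  obtain ⟨w, b, rfl, hw, hwb⟩ := exists_mul_eq_wordLength hA h (j := m)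
    (by exact_mod_cast hm.trans hleh)
  have hmid : ∀ z a : G, wordLength A z = m →
      wordLength A z + wordLength A a = wordLength A (z * a) →
      gromov (wordDist A) 1 z (z * a) = m := by
    intro z a hz hza
    rw [gromov, wordDist_one_left, wordDist_one_left, wordDist_mul_right, ← hza, ← hz]
    push_cast
    ring
  have hzw : wordDist A z w ≤ 4 * δ := by
    have h₁ := hhyp.sub_le_gromov (hmid z a hz hza).ge hm
    have h₂ : (m : ℝ) - δ ≤ gromov (wordDist A) 1 (w * b) w := by
      rw [hsymm, hmid w b hw hwb]
      linarith
    have h₃ := hhyp.sub_le_gromov h₁ h₂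
    rw [gromov, wordDist_one_left, wordDist_one_left, hz, hw] at h₃
    linarith
  have hφzw : (m : ℝ) / L - L * (4 * δ) ≤ gromov (wordDist A) 1 (φ z) (φ w) := by
    have h₁ := sub_wordDist_le_gromov hA 1 (φ z) (φ w)
    have h₂ := hub (z⁻¹ * w)
    have h₃ := hlb z
    have h₄ : L * wordDist A z w ≤ L * (4 * δ) := by gcongr
    rw [wordDist_one_left] at h₁
    rw [map_mul, map_inv] at h₂
    rw [hz] at h₃
    unfold wordDist at h₁ h₄ ⊢
    linarith
  have hg := hgeo _ z a rfl hza.symm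
  have hh := hgeo _ w b rfl hwb.symm
  rw [hz] at hg
  rw [hw] at hh
  have hLδ : 0 ≤ L * (4 * δ) := by positivity
  rw [hsymm] at hg
  have h₁ : (m : ℝ) / L - D - L * (4 * δ) - δ ≤ gromov (wordDist A) 1 (φ (z * a)) (φ w) :=
    hhyp.sub_le_gromov (by linarith) (by linarith)
  have h₂ := hhyp.sub_le_gromov h₁ (z := φ (w * b)) (by linarith)
  have h₅ : gromov (wordDist A) 1 (z * a) (w * b) / L ≤ (m + 1) / L := by gcongr
  rw [add_div] at h₅
  linarith

theorem satisfiesHolder_of_bijective (hA : Subgroup.closure A = ⊤) (hfin : A.Finite)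
    (hhyp : IsHyperbolic A) {p : G} {γ T : ℝ} (hγ : 0 < γ) (hT : 1 ≤ T) {d : G → G → ℝ}
    (hd : InVisual A p γ T d) (φ : G →* G) (hφ : Function.Bijective φ) :
    SatisfiesHolder d d φ := by
  obtain ⟨δ, hδ, hhyp⟩ := hhyp
  obtain ⟨L₁, hL₁⟩ := exists_wordLength_map_le hA hfin φ
  obtain ⟨L₂, hL₂⟩ := exists_wordLength_map_le hA hfin
    (MulEquiv.ofBijective φ hφ).symm.toMonoidHom
  set L : ℝ := L₁ + L₂ + 1
  have hL : 0 < L := by positivity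
  have hub : ∀ g, (wordLength A (φ g) : ℝ) ≤ L * wordLength A g := fun g => by
    have h : (wordLength A (φ g) : ℝ) ≤ L₁ * wordLength A g := by exact_mod_cast hL₁ g
    refine h.trans ?_
    gcongr
    linarith [(Nat.cast_nonneg L₂ : (0 : ℝ) ≤ L₂)]
  have hlb : ∀ g, (wordLength A g : ℝ) / L ≤ wordLength A (φ g) := fun g => by
    have h := hL₂ (φ g)
    rw [show (MulEquiv.ofBijective φ hφ).symm.toMonoidHom (φ g) = g from
      (MulEquiv.ofBijective φ hφ).symm_apply_apply g] at h
    have h' : (wordLength A g : ℝ) ≤ L₂ * wordLength A (φ g) := by exact_mod_cast h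
    rw [div_le_iff₀ hL, mul_comm]
    refine h'.trans ?_
    gcongr
    linarith [(Nat.cast_nonneg L₁ : (0 : ℝ) ≤ L₁)]
  obtain ⟨C, hC⟩ := exists_gromov_map_ge hA hδ hhyp φ hL hub hlb
  obtain ⟨hmet, hvis⟩ := hd
  have hT₀ : 0 < T := by linarith
  set B := wordDist A p 1 / L + C + wordDist A 1 p
  refine ⟨1 / L, by positivity, T * Real.exp (γ * B) * T ^ (1 / L), by positivity, fun g h => ?_⟩
  by_cases hgh : g = h
  · subst hgh
    rw [hmet.refl, hmet.refl, Real.zero_rpow (by positivity), mul_zero]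
  have hlow := (hvis g h hgh).1
  have hup := (hvis (φ g) (φ h) fun h' => hgh (hφ.1 h')).2
  rw [visualRhoOf, if_neg hgh, div_le_iff₀ hT₀] at hlow
  rw [visualRhoOf, if_neg fun h' => hgh (hφ.1 h')] at hup
  have hprod : gromov (wordDist A) p g h / L - B ≤ gromov (wordDist A) p (φ g) (φ h) := by
    have h₁ : gromov (wordDist A) p g h / L ≤
        (gromov (wordDist A) 1 g h + wordDist A p 1) / L := by
      gcongr
      exact gromov_wordDist_le_add hA p 1 g h
    have h₂ := gromov_wordDist_le_add hA 1 p (φ g) (φ h)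
    rw [add_div] at h₁
    linarith [hC g h]
  have hd₀ : 0 ≤ d g h := by
    have := hmet.triangle g h g
    rw [hmet.refl, hmet.symm h g] at this
    linarith
  calc d (φ g) (φ h)
      ≤ T * Real.exp (-γ * gromov (wordDist A) p (φ g) (φ h)) := hup
    _ ≤ T * Real.exp (γ * B + -γ * gromov (wordDist A) p g h * (1 / L)) := by
      gcongr
      have := mul_le_mul_of_nonneg_left hprod hγ.le
      rw [mul_sub, ← mul_div_assoc] at this
      rw [mul_one_div, neg_mul, neg_mul, neg_div]
      linarith
    _ = T * Real.exp (γ * B) * Real.exp (-γ * gromov (wordDist A) p g h) ^ (1 / L) := by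
      rw [Real.exp_add, Real.exp_mul (-γ * _), mul_assoc]
    _ ≤ T * Real.exp (γ * B) * (d g h * T) ^ (1 / L) := by gcongr
    _ = T * Real.exp (γ * B) * T ^ (1 / L) * d g h ^ (1 / L) := by
      rw [Real.mul_rpow hd₀ hT₀.le]
      ring

end QuasiIsometry

theorem SatisfiesHolder.unifCont {X : Type*} {d d' : X → X → ℝ} {φ : X → X}
    (hd : ∀ x y, 0 ≤ d x y) (h : SatisfiesHolder d d' φ) : UnifCont d d' φ := by
  obtain ⟨r, hr, K, hK, hφ⟩ := h
  intro ε hε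
  refine ⟨(ε / K) ^ r⁻¹, by positivity, fun g h hgh => (hφ g h).trans_lt ?_⟩
  have := Real.rpow_lt_rpow (hd g h) hgh hr
  rw [Real.rpow_inv_rpow (by positivity) hr.ne', lt_div_iff₀ hK] at this
  linarith

theorem finite_ker_of_unifCont {G : Type*} [Group G] {A : Set G}
    (hA : Subgroup.closure A = ⊤) (hfin : A.Finite) {p : G} {γ T : ℝ} (hγ : 0 < γ)
    (hT : 1 ≤ T) {d : G → G → ℝ} (hd : InVisual A p γ T d) (φ : G →* G)
    (hnt : ∃ g : G, φ g ≠ 1) (hφ : UnifCont d d φ) : {g : G | φ g = 1}.Finite := by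
  obtain ⟨hmet, hvis⟩ := hd
  obtain ⟨g, hg⟩ := hnt
  have hg₁ : g ≠ 1 := fun h => hg (by rw [h, map_one])
  have hT₀ : 0 < T := by linarith
  have hε : 0 < d 1 (φ g) := by
    have h₁ := hmet.triangle 1 (φ g) 1
    rw [hmet.refl, hmet.symm (φ g) 1] at h₁
    exact lt_of_le_of_ne (by linarith) fun h => hg (hmet.eq_of _ _ h.symm).symm
  obtain ⟨δ, hδ, hcont⟩ := hφ _ hε
  obtain ⟨n, hn⟩ := exists_nat_ge
    (-Real.log (δ / T) / γ + wordLength A g + wordDist A 1 p)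
  refine (finite_setOf_wordLength_le hA hfin n).subset fun k (hk : φ k = 1) => ?_
  have hne : k ≠ k * g := fun h => hg₁ (by simpa using h)
  have h₁ : δ ≤ d k (k * g) := by
    by_contra! h
    have := hcont _ _ h
    rw [map_mul, hk, one_mul] at this
    exact lt_irrefl _ this
  have h₂ := h₁.trans (hvis k (k * g) hne).2
  rw [visualRhoOf, if_neg hne, ← div_le_iff₀' hT₀,
    ← Real.log_le_iff_le_exp (by positivity)] at h₂
  have h₃ := sub_wordDist_le_gromov hA p k (k * g)
  rw [wordDist_mul_right] at h₃
  have h₄ := wordDist_triangle hA 1 p k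
  rw [wordDist_one_left k] at h₄
  have h₅ : gromov (wordDist A) p k (k * g) ≤ -Real.log (δ / T) / γ := by
    rw [le_div_iff₀ hγ]
    linarith
  have h₆ : (wordLength A k : ℝ) ≤ n := by linarith
  exact_mod_cast h₆

theorem injective_of_finite_ker {G H : Type*} [Group G] [Group H]
    (htf : ∀ g : G, g ≠ 1 → ¬IsOfFinOrder g) (φ : G →* H)
    (hfin : {g : G | φ g = 1}.Finite) : Function.Injective φ := by
  rw [injective_iff_map_eq_one]
  intro g hg
  by_contra hne
  refine htf g hne (finite_powers.1 (hfin.subset ?_))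
  rintro _ ⟨n, rfl⟩
  simp [hg]

/-- For a nontrivial endomorphism `φ` of a torsion-free co-hopfian
hyperbolic group with visual metric `d`, the following are equivalent: uniform
continuity, a Hölder condition, finiteness of the kernel, and `φ` being an
automorphism. -/
theorem stmt_11 {G : Type*} [Group G]
    (htf : ∀ g : G, g ≠ 1 → ¬IsOfFinOrder g)
    (hch : ∀ ψ : G →* G, Function.Injective ψ → Function.Surjective ψ)
    (A : Set G) (hAfin : A.Finite) (hAgen : Subgroup.closure A = ⊤)
    (hhyp : IsHyperbolic A)
    (p : G) (γ T : ℝ) (hγ : 0 < γ) (hT : 1 ≤ T)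
    (d : G → G → ℝ) (hd : InVisual A p γ T d)
    (φ : G →* G) (hnt : ∃ g : G, φ g ≠ 1) :
    List.TFAE [UnifCont d d ⇑φ, SatisfiesHolder d d ⇑φ,
      {g : G | φ g = 1}.Finite, Function.Bijective ⇑φ] := by
  have hnonneg : ∀ x y, 0 ≤ d x y := fun x y => by
    have := hd.1.triangle x y x
    rw [hd.1.refl, hd.1.symm y x] at this
    linarith
  tfae_have 1 → 3 := finite_ker_of_unifCont hAgen hAfin hγ hT hd φ hnt
  tfae_have 3 → 4 := fun h =>
    have hinj := injective_of_finite_ker htf φ h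
    ⟨hinj, hch φ hinj⟩
  tfae_have 4 → 2 := satisfiesHolder_of_bijective hAgen hAfin hhyp hγ hT hd φ
  tfae_have 2 → 1 := SatisfiesHolder.unifCont hnonneg
  tfae_finish
end

section
/- Let F_A be the free group on a finite set A, let d ∈ V^A(p,γ,T) be a visual metric on F_A, and let φ be an automorphism of F_A. Then φ satisfies a Lipschitz condition as a map from (F_A,d) to (F_A,d) if and only if there exist a permutation automorphism π of F_A (with respect to A) and x ∈ F_A such that gφ = x⁻¹(gπ)x for all g ∈ F_A, i.e. φ belongs to Per^A(F_A)·Inn(F_A). -/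
open scoped Classical

section FreeGroupDefs

variable {α : Type*} [DecidableEq α]

/-- The word length of an element of a free group: the length of its reduced word. -/
noncomputable def fgLen (g : FreeGroup α) : ℕ :=
  (FreeGroup.toWord g).length

/-- The word metric on the free group with respect to the basis `A` (as reals). -/
noncomputable def fgDist (g h : FreeGroup α) : ℝ :=
  (fgLen (g⁻¹ * h) : ℝ)

/-- The cyclic length `|g|_c`: the minimal word length of a conjugate of `g`. -/
noncomputable def cyclicLen (g : FreeGroup α) : ℕ :=
  sInf {n : ℕ | ∃ x : FreeGroup α, n = fgLen (x⁻¹ * g * x)}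

end FreeGroupDefs

/-- `π` is a permutation automorphism of the free group with respect to the basis:
it maps `A ∪ A⁻¹` bijectively onto itself. -/
def IsPermAut {α : Type*} (π : FreeGroup α ≃* FreeGroup α) : Prop :=
  ∀ a : α, ∃ b : α,
    π (FreeGroup.of a) = FreeGroup.of b ∨ π (FreeGroup.of a) = (FreeGroup.of b)⁻¹

section FreeGroupNorm

variable {α : Type*} [DecidableEq α]

open FreeGroup

theorem FreeGroup.norm_pow_of_isCyclicallyReduced {g : FreeGroup α}
    (hg : IsCyclicallyReduced g.toWord) (n : ℕ) : norm (g ^ n) = n * norm g := by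
  rw [norm, toWord_pow, (hg.flatten_replicate n).isReduced.reduce_eq]
  simp [norm]

theorem FreeGroup.isCyclicallyReduced_or_exists_toWord_eq (g : FreeGroup α) :
    IsCyclicallyReduced g.toWord ∨
      ∃ s w, g.toWord = s :: (w ++ [(s.1, !s.2)]) := by
  by_cases h : IsCyclicallyReduced g.toWord
  · exact .inl h
  right
  have hr : IsReduced g.toWord := isReduced_toWord
  rcases hL : g.toWord with _ | ⟨s, l⟩
  · simp [hL] at h
  rcases List.eq_nil_or_concat l with rfl | ⟨w, z, rfl⟩
  · simp [hL] at h
  rw [List.concat_eq_append] at *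
  rw [hL] at h hr
  have h' := h
  rw [← List.cons_append, isCyclicallyReduced_cons_append_iff] at h'
  have h2 : ¬ (z.1 = s.1 → z.2 = s.2) := fun h3 => h' ⟨hr, h3⟩
  push Not at h2
  refine ⟨s, w, ?_⟩
  have : z = (s.1, !s.2) := Prod.ext h2.1 (by simpa [Bool.eq_not] using h2.2)
  rw [this]

/-- If `g = s ⋯ s⁻¹`, `h` does not start with `s` and does not end with `s⁻¹`, then
the product `gh` is cyclically reduced as written. -/
theorem FreeGroup.isCyclicallyReduced_append {g h : FreeGroup α} {s : α × Bool}
    {w : List (α × Bool)} (hg : g.toWord = s :: (w ++ [(s.1, !s.2)]))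
    (hhead : ∀ y ∈ h.toWord.head?, y ≠ s)
    (hlast : ∀ z ∈ h.toWord.getLast?, z ≠ (s.1, !s.2)) (hne : h ≠ 1) :
    IsCyclicallyReduced (g.toWord ++ h.toWord) := by
  have hne' : h.toWord ≠ [] := by simpa using hne
  have hl : g.toWord.getLast? = some (s.1, !s.2) := by
    rw [hg, ← List.cons_append, List.getLast?_concat]
  refine ⟨List.IsChain.append isReduced_toWord isReduced_toWord ?_, ?_⟩
  · rw [hl]
    rintro _ ⟨⟩ y hy h1
    have := hhead y hy
    by_contra h2
    refine this (Prod.ext h1.symm ?_)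
    revert h2
    cases s.2 <;> cases y.2 <;> simp
  · intro z hz y hy h1
    rw [List.getLast?_append_of_ne_nil _ hne'] at hz
    have hy' : y = s := by
      simpa [hg, eq_comm] using hy
    subst hy'
    have := hlast z hz
    by_contra h2
    refine this (Prod.ext h1 ?_)
    revert h2
    cases z.2 <;> cases y.2 <;> simp

theorem FreeGroup.norm_le_of_norm_pow_le {g : FreeGroup α}
    (hg : IsCyclicallyReduced g.toWord) {m C : ℕ} (h : ∀ n, norm (g ^ n) ≤ n * m + C) :
    norm g ≤ m := by
  by_contra! hlt
  have h1 := h (C + 1)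
  rw [norm_pow_of_isCyclicallyReduced hg] at h1
  nlinarith

theorem FreeGroup.norm_pow_le (g : FreeGroup α) (n : ℕ) : norm (g ^ n) ≤ n * norm g := by
  induction n with
  | zero => simp
  | succ n ih =>
    rw [pow_succ]
    linarith [norm_mul_le (g ^ n) g]

theorem FreeGroup.norm_conj_le (x g : FreeGroup α) :
    norm (x⁻¹ * g * x) ≤ norm g + 2 * norm x := by
  have h1 := norm_mul_le (x⁻¹ * g) x
  have h2 := norm_mul_le x⁻¹ g
  rw [norm_inv_eq] at h2
  omega

theorem FreeGroup.norm_le_norm_conj (x g : FreeGroup α) :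
    norm g ≤ norm (x⁻¹ * g * x) + 2 * norm x := by
  have h := norm_conj_le x⁻¹ (x⁻¹ * g * x)
  rw [norm_inv_eq] at h
  convert h using 2
  group

/-- If an endomorphism `ψ` increases word length by at most a constant, some conjugate of `ψ`
maps every generator to an element of length at most one. -/
theorem FreeGroup.exists_conj_norm_le_one [Fintype α] (N : ℕ) :
    ∀ (ψ : FreeGroup α →* FreeGroup α) (C : ℕ), (∀ g, norm (ψ g) ≤ norm g + C) →
      ∑ a, norm (ψ (of a)) ≤ N → ∃ x : FreeGroup α, ∀ a, norm (x⁻¹ * ψ (of a) * x) ≤ 1 := by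
  induction N with
  | zero =>
    intro ψ C _ hN
    refine ⟨1, fun a => ?_⟩
    have := Finset.single_le_sum (f := fun a => norm (ψ (of a))) (fun _ _ => Nat.zero_le _)
      (Finset.mem_univ a)
    simp only [inv_one, one_mul, mul_one]
    omega
  | succ N ih =>
    intro ψ C hψ hN
    by_cases hall : ∀ a, norm (ψ (of a)) ≤ 1
    · exact ⟨1, by simpa using hall⟩
    push Not at hall
    obtain ⟨a, ha⟩ := hall
    have hpow (g : FreeGroup α) (n : ℕ) : norm (ψ g ^ n) ≤ n * norm g + C := by
      rw [← _root_.map_pow]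
      exact (hψ _).trans (Nat.add_le_add_right (norm_pow_le g n) C)
    have hshape (b : α) : norm (ψ (of b)) ≤ 1 ∨
        ∃ s w, (ψ (of b)).toWord = s :: (w ++ [(s.1, !s.2)]) := by
      refine (isCyclicallyReduced_or_exists_toWord_eq _).imp_left fun h => ?_
      have := norm_le_of_norm_pow_le h (hpow (of b))
      rwa [norm_of] at this
    obtain ⟨s, w, hs⟩ := (hshape a).resolve_left (by omega)
    have hmk {g : FreeGroup α} {v : List (α × Bool)} (hg : g.toWord = s :: (v ++ [(s.1, !s.2)])) :
        (mk [s])⁻¹ * g * mk [s] = mk v := by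
      have : g = mk [s] * mk v * (mk [s])⁻¹ := by
        rw [← mk_toWord (x := g), hg, inv_mk, mul_mk, mul_mk]
        simp [invRev]
      rw [this]
      group
    have hlt {g : FreeGroup α} {v : List (α × Bool)} (hg : g.toWord = s :: (v ++ [(s.1, !s.2)])) :
        norm ((mk [s])⁻¹ * g * mk [s]) < norm g := by
      rw [hmk hg]
      refine norm_mk_le.trans_lt ?_
      simp only [norm, hg, List.length_cons, List.length_append]
      omega
    have hle (b : α) : norm ((mk [s])⁻¹ * ψ (of b) * mk [s]) ≤ norm (ψ (of b)) := by
      by_cases h1 : ψ (of b) = 1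
      · rw [h1, mul_one, inv_mul_cancel]
      have hcontra (hhead : ∀ y ∈ (ψ (of b)).toWord.head?, y ≠ s)
          (hlast : ∀ z ∈ (ψ (of b)).toWord.getLast?, z ≠ (s.1, !s.2)) : False := by
        have hc := isCyclicallyReduced_append hs hhead hlast h1
        have hw : (ψ (of a * of b)).toWord = (ψ (of a)).toWord ++ (ψ (of b)).toWord := by
          rw [_root_.map_mul, toWord_mul, hc.isReduced.reduce_eq]
        rw [← hw] at hc
        have h2 := norm_le_of_norm_pow_le hc (hpow (of a * of b))
        have h3 := norm_mul_le (of a) (of b)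
        have h4 : norm (ψ (of a * of b)) = norm (ψ (of a)) + norm (ψ (of b)) := by
          rw [norm, hw, List.length_append, norm, norm]
        have h5 : norm (ψ (of b)) ≠ 0 := by simpa using h1
        rw [norm_of, norm_of] at h3
        omega
      rcases hshape b with hb | ⟨t, v, ht⟩
      · obtain ⟨y, hy⟩ : ∃ y, (ψ (of b)).toWord = [y] := by
          rw [← List.length_eq_one_iff]
          have h5 : norm (ψ (of b)) ≠ 0 := by simpa using h1
          change norm (ψ (of b)) = 1
          omega
        have hψb : ψ (of b) = mk [y] := by rw [← hy, mk_toWord]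
        by_cases hys : y = s
        · rw [hψb, hys, inv_mul_cancel, one_mul]
        by_cases hys' : y = (s.1, !s.2)
        · have : ψ (of b) = (mk [s])⁻¹ := by
            rw [hψb, hys', inv_mk]
            simp [invRev]
          rw [this, inv_mul_cancel_right]
        · exact (hcontra (by simpa [hy] using hys) (by simpa [hy] using hys')).elim
      · by_cases hts : t = s
        · subst hts
          exact (hlt ht).le
        · refine (hcontra (by simpa [ht] using hts) ?_).elim
          intro z hz hzs
          rw [ht, ← List.cons_append, List.getLast?_concat, Option.mem_some_iff] at hz
          rw [← hz] at hzs
          simp only [Prod.mk.injEq, Bool.not_inj_iff] at hzs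
          exact hts (Prod.ext hzs.1 hzs.2)
    obtain ⟨x, hx⟩ := ih ((MulAut.conj (mk [s])⁻¹).toMonoidHom.comp ψ) (C + 2 * norm (mk [s]))
      (fun g => by
        have h1 := norm_conj_le (mk [s]) (ψ g)
        have h2 := hψ g
        simp only [MonoidHom.comp_apply, MulEquiv.toMonoidHom_eq_coe, MonoidHom.coe_coe,
          MulAut.conj_apply, inv_inv]
        omega)
      (by
        simp only [MonoidHom.comp_apply, MulEquiv.toMonoidHom_eq_coe, MonoidHom.coe_coe,
          MulAut.conj_apply, inv_inv]
        have := Finset.sum_lt_sum (fun b _ => hle b) ⟨a, Finset.mem_univ a, hlt hs⟩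
        omega)
    refine ⟨mk [s] * x, fun b => ?_⟩
    convert hx b using 2
    simp [mul_assoc]

theorem FreeGroup.eq_of_or_eq_inv_of_norm_eq_one {g : FreeGroup α} (hg : norm g = 1) :
    ∃ a, g = of a ∨ g = (of a)⁻¹ := by
  obtain ⟨⟨a, b⟩, hab⟩ := List.length_eq_one_iff.1 (show g.toWord.length = 1 from hg)
  have : g = mk [(a, b)] := by rw [← hab, mk_toWord]
  refine ⟨a, ?_⟩
  cases b
  · exact .inr (by rw [this, of, inv_mk]; rfl)
  · exact .inl this

theorem FreeGroup.norm_map_le {ψ : FreeGroup α →* FreeGroup α}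
    (hψ : ∀ a, norm (ψ (of a)) ≤ 1) (g : FreeGroup α) : norm (ψ g) ≤ norm g := by
  have key (L : List (α × Bool)) : norm (ψ (mk L)) ≤ L.length := by
    induction L with
    | nil => simp [← one_eq_mk]
    | cons y L ih =>
      have h1 : mk (y :: L) = mk [y] * mk L := by simp
      have h2 : norm (ψ (mk [y])) ≤ 1 := by
        obtain ⟨a, b⟩ := y
        cases b
        · have : mk [(a, false)] = (of a)⁻¹ := by rw [of, inv_mk]; rfl
          rw [this, _root_.map_inv, norm_inv_eq]
          exact hψ a
        · exact hψ a
      rw [h1, _root_.map_mul, List.length_cons]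
      have := norm_mul_le (ψ (mk [y])) (ψ (mk L))
      omega
  simpa only [mk_toWord, norm] using key g.toWord

end FreeGroupNorm

section IsPermAut

variable {α : Type*}

open FreeGroup

theorem FreeGroup.of_ne_inv_of (a b : α) : of a ≠ (of b)⁻¹ := by
  intro h
  have := congrArg toWord h
  simp [toWord_inv, invRev] at this

theorem IsPermAut.symm [Finite α] {π : FreeGroup α ≃* FreeGroup α} (hπ : IsPermAut π) :
    IsPermAut π.symm := by
  choose f hf using hπ
  have hinj : Function.Injective f := by
    intro a b hab
    have ha := hf a
    have hb := hf b
    rw [← hab] at hb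
    rcases ha with ha | ha <;> rcases hb with hb | hb
    · exact of_injective (π.injective (ha.trans hb.symm))
    · refine (of_ne_inv_of a b (π.injective ?_)).elim
      rw [_root_.map_inv, ha, hb, inv_inv]
    · refine (of_ne_inv_of a b (π.injective ?_)).elim
      rw [_root_.map_inv, ha, hb]
    · exact of_injective (π.injective (ha.trans hb.symm))
  intro b
  obtain ⟨a, rfl⟩ := Finite.surjective_of_injective hinj b
  refine ⟨a, (hf a).imp (fun h => ?_) (fun h => ?_)⟩
  · rw [← h, π.symm_apply_apply]
  · rw [MulEquiv.symm_apply_eq, _root_.map_inv, h, inv_inv]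

theorem IsPermAut.norm_apply [DecidableEq α] [Finite α] {π : FreeGroup α ≃* FreeGroup α}
    (hπ : IsPermAut π) (g : FreeGroup α) : norm (π g) = norm g := by
  have hone {σ : FreeGroup α ≃* FreeGroup α} (hσ : IsPermAut σ) (g : FreeGroup α) :
      norm (σ g) ≤ norm g := by
    refine norm_map_le (ψ := σ.toMonoidHom) (fun a => ?_) g
    obtain ⟨b, h | h⟩ := hσ a <;> simp [h]
  refine (hone hπ g).antisymm ?_
  simpa using hone hπ.symm (π g)

end IsPermAut

section VisualMetric

variable {α : Type*} [DecidableEq α]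

open FreeGroup

theorem fgDist_eq_norm (g h : FreeGroup α) : fgDist g h = (FreeGroup.norm (g⁻¹ * h) : ℝ) := rfl

theorem fgDist_comm (g h : FreeGroup α) : fgDist g h = fgDist h g := by
  rw [fgDist_eq_norm, fgDist_eq_norm, ← norm_inv_eq (x := g⁻¹ * h)]
  simp

theorem fgDist_triangle (f g h : FreeGroup α) : fgDist f h ≤ fgDist f g + fgDist g h := by
  simp only [fgDist_eq_norm]
  have := norm_mul_le (f⁻¹ * g) (g⁻¹ * h)
  simp only [mul_assoc, mul_inv_cancel_left] at this
  exact_mod_cast this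

theorem fgDist_one_left (g : FreeGroup α) : fgDist 1 g = FreeGroup.norm g := by
  simp [fgDist_eq_norm]

theorem gromov_fgDist_le (p g h : FreeGroup α) : gromov fgDist p g h ≤ fgDist p g := by
  have := fgDist_triangle p g h
  rw [gromov]
  linarith

theorem le_gromov_fgDist (p g h : FreeGroup α) :
    fgDist p g - fgDist g h ≤ gromov fgDist p g h := by
  have := fgDist_triangle p h g
  have := fgDist_comm g h
  rw [gromov]
  linarith

theorem lipschitzCond_iff_gromov {p : FreeGroup α} {γ T : ℝ} (hγ : 0 < γ) (hT : 1 ≤ T)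
    {d : FreeGroup α → FreeGroup α → ℝ} (hd : InVisualOf fgDist p γ T d)
    {φ : FreeGroup α → FreeGroup α} (hφ : Function.Injective φ) :
    LipschitzCond d d φ ↔
      ∃ C : ℝ, ∀ g h, g ≠ h → gromov fgDist p g h ≤ gromov fgDist p (φ g) (φ h) + C := by
  have hT0 : 0 < T := by linarith
  constructor
  · rintro ⟨K, hK, hlip⟩
    refine ⟨Real.log (K * T * T) / γ, fun g h hgh => ?_⟩
    have h1 := (hd.2 (φ g) (φ h) (hφ.ne hgh)).1
    have h2 := (hd.2 g h hgh).2
    rw [visualRhoOf, if_neg hgh] at h2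
    rw [visualRhoOf, if_neg (hφ.ne hgh), div_le_iff₀ hT0] at h1
    have h3 : Real.exp (-γ * gromov fgDist p (φ g) (φ h)) ≤
        K * T * T * Real.exp (-γ * gromov fgDist p g h) := by
      calc _ ≤ d (φ g) (φ h) * T := h1
        _ ≤ (K * d g h) * T := by gcongr; exact hlip g h
        _ ≤ (K * (T * Real.exp (-γ * gromov fgDist p g h))) * T := by gcongr
        _ = _ := by ring
    have h4 : 0 < K * T * T := by positivity
    rw [← Real.exp_log h4, ← Real.exp_add, Real.exp_le_exp] at h3
    rw [← sub_le_iff_le_add', le_div_iff₀ hγ]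
    linarith
  · rintro ⟨C, hC⟩
    refine ⟨T * T * Real.exp (γ * C), by positivity, fun g h => ?_⟩
    rcases eq_or_ne g h with rfl | hgh
    · simp [hd.1.refl]
    have h1 := (hd.2 (φ g) (φ h) (hφ.ne hgh)).2
    have h2 := (hd.2 g h hgh).1
    rw [visualRhoOf, if_neg hgh, div_le_iff₀ hT0] at h2
    rw [visualRhoOf, if_neg (hφ.ne hgh)] at h1
    have h3 := mul_le_mul_of_nonneg_left (hC g h hgh) hγ.le
    calc _ ≤ T * Real.exp (-γ * gromov fgDist p (φ g) (φ h)) := h1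
      _ ≤ T * Real.exp (γ * C + -γ * gromov fgDist p g h) := by
        gcongr
        linarith
      _ = T * Real.exp (γ * C) * Real.exp (-γ * gromov fgDist p g h) := by
        rw [Real.exp_add]
        ring
      _ ≤ T * Real.exp (γ * C) * (d g h * T) := by gcongr
      _ = _ := by ring

/-- A Lipschitz map decreases word length by at most a constant. -/
theorem exists_norm_le_of_gromov_le [Nonempty α] {p : FreeGroup α}
    {φ : FreeGroup α → FreeGroup α} {C : ℝ}
    (hC : ∀ g h, g ≠ h → gromov fgDist p g h ≤ gromov fgDist p (φ g) (φ h) + C) :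
    ∃ D : ℕ, ∀ g, FreeGroup.norm g ≤ FreeGroup.norm (φ g) + D := by
  obtain ⟨a⟩ := ‹Nonempty α›
  refine ⟨⌈C + 2 * FreeGroup.norm p + 1⌉₊, fun g => ?_⟩
  have hne : g ≠ g * of a := by simp [of_ne_one]
  have h1 := hC g (g * of a) hne
  have h2 := le_gromov_fgDist p g (g * of a)
  have h3 := gromov_fgDist_le p (φ g) (φ (g * of a))
  have h4 : fgDist g (g * of a) = 1 := by simp [fgDist_eq_norm]
  have h5 := fgDist_triangle p 1 (φ g)
  have h6 := fgDist_triangle 1 p g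
  rw [fgDist_comm p 1] at h5
  simp only [fgDist_one_left] at h5 h6
  have h7 := Nat.le_ceil (C + 2 * FreeGroup.norm p + 1)
  have : (FreeGroup.norm g : ℝ) ≤
      FreeGroup.norm (φ g) + ⌈C + 2 * FreeGroup.norm p + 1⌉₊ := by linarith
  exact_mod_cast this

theorem gromov_le_of_norm_near {p : FreeGroup α} {φ : FreeGroup α ≃* FreeGroup α} {D : ℕ}
    (hle : ∀ g, FreeGroup.norm (φ g) ≤ FreeGroup.norm g + D)
    (hge : ∀ g, FreeGroup.norm g ≤ FreeGroup.norm (φ g) + D)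
    (g h : FreeGroup α) :
    gromov fgDist p g h ≤ gromov fgDist p (φ g) (φ h) + (2 * FreeGroup.norm p + 3 / 2 * D) := by
  have hp (g : FreeGroup α) : fgDist p g ≤ fgDist p (φ g) + (2 * FreeGroup.norm p + D) := by
    have h1 := fgDist_triangle p 1 g
    have h2 := fgDist_triangle 1 p (φ g)
    have h3 : (FreeGroup.norm g : ℝ) ≤ FreeGroup.norm (φ g) + D := by exact_mod_cast hge g
    rw [fgDist_comm p 1] at h1
    simp only [fgDist_one_left] at h1 h2
    linarith
  have hgh : fgDist (φ g) (φ h) ≤ fgDist g h + D := by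
    rw [fgDist_eq_norm, fgDist_eq_norm, ← _root_.map_inv, ← _root_.map_mul]
    exact_mod_cast hle (g⁻¹ * h)
  have := hp g
  have := hp h
  rw [gromov, gromov]
  linarith

end VisualMetric

/-- An automorphism of a finitely generated free group satisfies a
Lipschitz condition with respect to a visual metric `d ∈ V^A(p,γ,T)` iff it is the
composition of a permutation automorphism with an inner automorphism. -/
theorem stmt_15 {α : Type*} [Fintype α] [DecidableEq α]
    (p : FreeGroup α) (γ T : ℝ) (hγ : 0 < γ) (hT : 1 ≤ T)
    (d : FreeGroup α → FreeGroup α → ℝ) (hd : InVisualOf fgDist p γ T d)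
    (φ : FreeGroup α ≃* FreeGroup α) :
    LipschitzCond d d ⇑φ ↔
      ∃ π : FreeGroup α ≃* FreeGroup α, IsPermAut π ∧
        ∃ x : FreeGroup α, ∀ g : FreeGroup α, φ g = x⁻¹ * π g * x := by
  rw [lipschitzCond_iff_gromov hγ hT hd φ.injective]
  constructor
  · rintro ⟨C, hC⟩
    rcases isEmpty_or_nonempty α with hα | hα
    · exact ⟨φ, isEmptyElim, 1, by simp⟩
    obtain ⟨D, hD⟩ := exists_norm_le_of_gromov_le hC
    obtain ⟨x, hx⟩ := FreeGroup.exists_conj_norm_le_one _ φ.symm.toMonoidHom D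
      (fun g => by simpa using hD (φ.symm g)) le_rfl
    have hσ : IsPermAut (φ.symm.trans (MulAut.conj x⁻¹)) := by
      intro a
      refine FreeGroup.eq_of_or_eq_inv_of_norm_eq_one (le_antisymm ?_ ?_)
      · simpa using hx a
      · rw [Nat.one_le_iff_ne_zero, Ne, FreeGroup.norm_eq_zero, EmbeddingLike.map_eq_one_iff]
        exact FreeGroup.of_ne_one a
    refine ⟨_, hσ.symm, φ x, fun g => ?_⟩
    simp [MulEquiv.symm_trans_apply, mul_assoc]
  · rintro ⟨π, hπ, x, hφ⟩
    refine ⟨2 * FreeGroup.norm p + 3 / 2 * (2 * FreeGroup.norm x : ℕ), fun g h _ =>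
      gromov_le_of_norm_near (fun g => ?_) (fun g => ?_) g h⟩
    · rw [hφ, ← hπ.norm_apply g]
      exact FreeGroup.norm_conj_le x (π g)
    · rw [hφ, ← hπ.norm_apply g]
      exact FreeGroup.norm_le_norm_conj x (π g)
end

section
/- Let F_A be the free group on a finite set A with |A| > 2 and let φ be an automorphism of F_A. Then φ satisfies a Lipschitz condition with respect to every visual metric d ∈ V^{A'}(p,γ,T) where A' ranges over all bases of F_A, if and only if φ is an inner automorphism. -/
open scoped Classical

namespace FreeGroup

variable {α : Type*}

theorem mk_false (a : α) : mk [(a, false)] = (of a)⁻¹ := by simp [of, inv_mk, invRev]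

theorem mk_true (a : α) : mk [(a, true)] = of a := rfl

theorem mk_singleton_eq_zpow (a : α) (s : Bool) : ∃ i : ℤ, mk [(a, s)] = of a ^ i := by
  cases s
  · exact ⟨-1, by simp [mk_false]⟩
  · exact ⟨1, by simp [mk_true]⟩

variable [DecidableEq α]

/-- The lengths of the powers of `g` grow at most linearly with slope `k`. -/
def PowLengthLE (g : FreeGroup α) (k : ℕ) : Prop :=
  ∃ C : ℕ, ∀ n : ℕ, norm (g ^ n) ≤ n * k + C

theorem PowLengthLE.conj {g : FreeGroup α} {k : ℕ} (h : PowLengthLE g k) (u : FreeGroup α) :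
    PowLengthLE (u * g * u⁻¹) k := by
  obtain ⟨C, hC⟩ := h
  refine ⟨C + 2 * norm u, fun n => ?_⟩
  rw [conj_pow]
  have h1 := norm_mul_le (u * g ^ n) u⁻¹
  have h2 := norm_mul_le u (g ^ n)
  have h3 := hC n
  rw [norm_inv_eq] at h1
  omega

theorem PowLengthLE.of_conj {g u : FreeGroup α} {k : ℕ} (h : PowLengthLE (u * g * u⁻¹) k) :
    PowLengthLE g k := by
  have := h.conj u⁻¹
  simpa [mul_assoc] using this

theorem PowLengthLE.length_le {L : List (α × Bool)} {k : ℕ} (h : PowLengthLE (mk L) k)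
    (hL : IsCyclicallyReduced L) : L.length ≤ k := by
  obtain ⟨C, hC⟩ := h
  have h1 := hC (C + 1)
  rw [pow_mk, norm, toWord_mk, (hL.flatten_replicate _).isReduced.reduce_eq] at h1
  simp only [List.length_flatten, List.map_replicate, List.sum_replicate, smul_eq_mul] at h1
  by_contra! hlt
  have : (C + 1) * (k + 1) ≤ (C + 1) * L.length := Nat.mul_le_mul_left _ hlt
  rw [mul_add] at this
  omega

theorem PowLengthLE.exists_conj {g : FreeGroup α} {k : ℕ} (h : PowLengthLE g k) :
    ∃ (u : FreeGroup α) (L : List (α × Bool)), L.length ≤ k ∧ g = u * mk L * u⁻¹ := by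
  have hg : g = mk (reduceCyclically.conjugator g.toWord) * mk (reduceCyclically g.toWord) *
      (mk (reduceCyclically.conjugator g.toWord))⁻¹ := by
    rw [inv_mk, mul_mk, mul_mk, reduceCyclically.conj_conjugator_reduceCyclically, mk_toWord]
  refine ⟨_, _, ?_, hg⟩
  rw [hg] at h
  exact h.of_conj.length_le (reduceCyclically.isCyclicallyReduced isReduced_toWord)

theorem IsReduced.invRev {L : List (α × Bool)} (h : IsReduced L) :
    IsReduced (FreeGroup.invRev L) := by
  rw [isReduced_iff_reduce_eq] at h ⊢
  rw [reduce_invRev, h]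

theorem isCyclicallyReduced_letter_append_letter_append_invRev {a b : α} (hab : a ≠ b)
    (s t : Bool) {L : List (α × Bool)} (hL : IsReduced L) (ha : ∀ x ∈ L.head?, x.1 ≠ a)
    (hb : ∀ x ∈ L.getLast?, x.1 ≠ b) :
    IsCyclicallyReduced ([(a, s)] ++ L ++ [(b, t)] ++ invRev L) := by
  have hr := hL.invRev
  have h1 : ∀ x ∈ (invRev L).head?, x.1 ≠ b := by
    intro x hx
    simp only [invRev, List.head?_reverse, List.getLast?_map, Option.mem_def,
      Option.map_eq_some_iff] at hx
    obtain ⟨y, hy, rfl⟩ := hx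
    exact hb y hy
  have h2 : ∀ x ∈ (invRev L).getLast?, x.1 ≠ a := by
    intro x hx
    simp only [invRev, List.getLast?_reverse, List.head?_map, Option.mem_def,
      Option.map_eq_some_iff] at hx
    obtain ⟨y, hy, rfl⟩ := hx
    exact ha y hy
  generalize invRev L = M at *
  unfold IsReduced at hL hr
  unfold IsCyclicallyReduced IsReduced
  simp only [List.isChain_append, List.getLast?_append, List.head?_append]
  generalize L.head? = lh, L.getLast? = ll, M.head? = mh, M.getLast? = ml at *
  cases lh <;> cases ll <;> cases mh <;> cases ml <;> simp_all <;> grind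

theorem exists_zpow_mul_zpow_of_powLengthLE {a b : α} (hab : a ≠ b) (s t : Bool)
    (g : FreeGroup α) (h : PowLengthLE (mk [(a, s)] * g * mk [(b, t)] * g⁻¹) 2) :
    ∃ i j : ℤ, g = of a ^ i * of b ^ j := by
  induction hn : norm g using Nat.strong_induction_on generalizing g with
  | _ n ih =>
  subst hn
  obtain ⟨i₀, hi₀⟩ := mk_singleton_eq_zpow a s
  obtain ⟨j₀, hj₀⟩ := mk_singleton_eq_zpow b t
  by_cases ha : ∀ x ∈ g.toWord.head?, x.1 ≠ a
  · by_cases hb : ∀ x ∈ g.toWord.getLast?, x.1 ≠ b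
    · have hc := isCyclicallyReduced_letter_append_letter_append_invRev hab s t isReduced_toWord
        ha hb
      rw [← mk_toWord (x := g), inv_mk, mul_mk, mul_mk, mul_mk] at h
      have := h.length_le hc
      simp only [List.length_append, List.length_singleton, invRev_length] at this
      have h0 : g.toWord = [] := List.length_eq_zero_iff.1 (by omega)
      rw [toWord_eq_nil_iff] at h0
      exact ⟨0, 0, by simp [h0]⟩
    · push Not at hb
      obtain ⟨⟨b', r⟩, hx, rfl⟩ := hb
      obtain ⟨L, hL⟩ := List.getLast?_eq_some_iff.1 hx
      obtain ⟨j, hj⟩ := mk_singleton_eq_zpow b' r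
      have hg : g = mk L * of b' ^ j := by rw [← hj, mul_mk, ← hL, mk_toWord]
      have hlt : norm (mk L) < norm g := by
        refine norm_mk_le.trans_lt ?_
        rw [norm, hL]; simp
      obtain ⟨i, j', h'⟩ := ih _ hlt (mk L) (by
        convert h using 1
        rw [hg, hj₀]; group) rfl
      exact ⟨i, j' + j, by rw [hg, h', zpow_add, mul_assoc]⟩
  · push Not at ha
    obtain ⟨⟨a', r⟩, hx, rfl⟩ := ha
    obtain ⟨L, hL⟩ := List.head?_eq_some_iff.1 hx
    obtain ⟨i, hi⟩ := mk_singleton_eq_zpow a' r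
    have hg : g = of a' ^ i * mk L := by
      rw [← hi, mul_mk, List.singleton_append, ← hL, mk_toWord]
    have hlt : norm (mk L) < norm g := by
      refine norm_mk_le.trans_lt ?_
      rw [norm, hL]; simp
    obtain ⟨i', j, h'⟩ := ih _ hlt (mk L) (by
      have := h.conj (of a' ^ i)⁻¹
      convert this using 1
      rw [hg, hi₀]; group) rfl
    exact ⟨i + i', j, by rw [hg, h', zpow_add, mul_assoc]⟩

/-- The automorphism `a ↦ a * b` fixing all generators other than `a`. -/
def transvection {a b : α} (hab : a ≠ b) : FreeGroup α ≃* FreeGroup α :=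
  MonoidHom.toMulEquiv
    (lift fun c => if c = a then of a * of b else of c)
    (lift fun c => if c = a then of a * (of b)⁻¹ else of c)
    (by ext c; by_cases h : c = a <;> simp [h, hab.symm])
    (by ext c; by_cases h : c = a <;> simp [h, hab.symm])

theorem transvection_of_self {a b : α} (hab : a ≠ b) :
    transvection hab (of a) = of a * of b := by
  simp [transvection]

theorem transvection_of_ne {a b c : α} (hab : a ≠ b) (hc : c ≠ a) :
    transvection hab (of c) = of c := by
  simp [transvection, hc]

theorem transvection_symm_of_self {a b : α} (hab : a ≠ b) :
    (transvection hab).symm (of a) = of a * (of b)⁻¹ := by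
  simp [transvection]

theorem transvection_symm_of_ne {a b c : α} (hab : a ≠ b) (hc : c ≠ a) :
    (transvection hab).symm (of c) = of c := by
  simp [transvection, hc]

/-- In every basis, the automorphism `η` does not increase the translation length of an element
beyond its word length. -/
def NonExpanding (η : FreeGroup α ≃* FreeGroup α) : Prop :=
  ∀ (ψ : FreeGroup α ≃* FreeGroup α) (g : FreeGroup α),
    PowLengthLE (ψ.symm (η (ψ g))) (norm g)

theorem NonExpanding.conj {η : FreeGroup α ≃* FreeGroup α} (h : NonExpanding η)
    (u : FreeGroup α) : NonExpanding (η.trans (MulAut.conj u)) := by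
  intro ψ g
  simpa using (h ψ g).conj (ψ.symm u)

theorem NonExpanding.map_of {η : FreeGroup α ≃* FreeGroup α} (h : NonExpanding η) (a : α) :
    ∃ (u : FreeGroup α) (s : Bool), η (of a) = u * mk [(a, s)] * u⁻¹ := by
  have h1 := h (MulEquiv.refl _) (of a)
  rw [norm_of] at h1
  obtain ⟨u, L, hL, hu⟩ := h1.exists_conj
  replace hu : η (of a) = u * mk L * u⁻¹ := hu
  match L, hL with
  | [], _ =>
    rw [← one_eq_mk] at hu
    simp [of_ne_one] at hu
  | [(b, s)], _ =>
    by_cases hab : b = a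
    · exact ⟨u, s, hab ▸ hu⟩
    exfalso
    have h2 := h (transvection hab) (of a)
    rw [transvection_of_ne hab (Ne.symm hab), hu, norm_of, _root_.map_mul, _root_.map_mul,
      _root_.map_inv] at h2
    replace h2 := h2.of_conj
    cases s
    · rw [mk_false, _root_.map_inv, transvection_symm_of_self, mul_inv_rev, inv_inv, ← mk_false,
        ← mk_true, mul_mk] at h2
      have := h2.length_le (by simp [IsCyclicallyReduced, IsReduced, hab, Ne.symm hab])
      simp at this
    · rw [mk_true, transvection_symm_of_self, ← mk_false, ← mk_true, mul_mk] at h2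
      have := h2.length_le (by simp [IsCyclicallyReduced, IsReduced, hab, Ne.symm hab])
      simp at this

theorem NonExpanding.exists_zpow_mul_zpow {η : FreeGroup α ≃* FreeGroup α} (h : NonExpanding η)
    {a b : α} (hab : a ≠ b) {s t : Bool} {g : FreeGroup α} (ha : η (of a) = mk [(a, s)])
    (hb : η (of b) = g * mk [(b, t)] * g⁻¹) : ∃ i j : ℤ, g = of a ^ i * of b ^ j := by
  refine exists_zpow_mul_zpow_of_powLengthLE hab s t g ?_
  have h1 := h (MulEquiv.refl _) (of a * of b)
  have h2 : norm (of a * of b) = 2 := by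
    simp [norm, toWord_mul]
  rw [h2] at h1
  simpa [ha, hb, mul_assoc] using h1

theorem NonExpanding.exists_conj_letter [Nontrivial α] {η : FreeGroup α ≃* FreeGroup α}
    (h : NonExpanding η) :
    ∃ u : FreeGroup α, ∀ a, ∃ s : Bool, u * η (of a) * u⁻¹ = mk [(a, s)] := by
  obtain ⟨a, b, hab⟩ := exists_pair_ne α
  obtain ⟨u, s, hu⟩ := h.map_of a
  have h1 := h.conj u⁻¹
  have ha : (η.trans (MulAut.conj u⁻¹)) (of a) = mk [(a, s)] := by simp [hu, mul_assoc]
  obtain ⟨g, t, hg⟩ := h1.map_of b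
  obtain ⟨i, j, rfl⟩ := h1.exists_zpow_mul_zpow hab ha hg
  obtain ⟨k, hk⟩ := mk_singleton_eq_zpow a s
  obtain ⟨l, hl⟩ := mk_singleton_eq_zpow b t
  have h2 := h.conj (of a ^ (-i) * u⁻¹)
  set θ := η.trans (MulAut.conj (of a ^ (-i) * u⁻¹)) with hθ
  have ha' : θ (of a) = mk [(a, s)] := by
    simp only [hθ, MulEquiv.trans_apply, MulAut.conj_apply, hu, hk]
    group
  have hb' : θ (of b) = mk [(b, t)] := by
    have : θ (of b) = of a ^ (-i) * (η.trans (MulAut.conj u⁻¹)) (of b) * (of a ^ (-i))⁻¹ := by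
      simp only [hθ, MulEquiv.trans_apply, MulAut.conj_apply]
      group
    rw [this, hg, hl]
    group
  refine ⟨of a ^ (-i) * u⁻¹, fun c => ?_⟩
  change ∃ r, θ (of c) = _
  by_cases hca : c = a
  · exact ⟨s, hca ▸ ha'⟩
  by_cases hcb : c = b
  · exact ⟨t, hcb ▸ hb'⟩
  obtain ⟨v, r, hv⟩ := h2.map_of c
  obtain ⟨m, n, h3⟩ := h2.exists_zpow_mul_zpow (Ne.symm hca) ha' hv
  obtain ⟨m', n', h4⟩ := h2.exists_zpow_mul_zpow (Ne.symm hcb) hb' hv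
  have hm : m = 0 := by
    have := congrArg (lift fun x => if x = a then Multiplicative.ofAdd (1 : ℤ) else 1)
      (h3.symm.trans h4)
    simpa [hca, hab.symm, ← ofAdd_zsmul] using this
  obtain ⟨q, hq⟩ := mk_singleton_eq_zpow c r
  refine ⟨r, ?_⟩
  rw [hv, h3, hm, hq]
  group

theorem NonExpanding.eq_of_of_forall_letter {η : FreeGroup α ≃* FreeGroup α}
    (h : NonExpanding η) {s : α → Bool} (hs : ∀ a, η (of a) = mk [(a, s a)])
    {a b c : α} (hab : a ≠ b) (hac : a ≠ c) (hbc : b ≠ c) : η (of a) = of a := by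
  have sign : ∀ {x y : α}, x ≠ y → s x = true → s y = true := by
    intro x y hxy hx
    by_contra hy
    have h1 := h (transvection hxy) (of x)
    rw [transvection_of_self, norm_of, _root_.map_mul, _root_.map_mul, hs, hs, hx,
      Bool.eq_false_of_not_eq_true hy,
      mk_true, mk_false, _root_.map_inv, transvection_symm_of_self, transvection_symm_of_ne _ hxy.symm,
      ← mk_true, ← mk_false, mul_mk, mul_mk] at h1
    have := h1.length_le (by simp [IsCyclicallyReduced, IsReduced, hxy, hxy.symm])
    simp at this
  rw [hs]
  by_cases ha : s a = true
  · rw [ha, mk_true]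
  exfalso
  have hb : s b = false := Bool.eq_false_of_not_eq_true fun hb => ha (sign hab.symm hb)
  have hc : s c = false := Bool.eq_false_of_not_eq_true fun hc => ha (sign hac.symm hc)
  have h1 := h (transvection hab) (of a * of c)
  have h2 : norm (of a * of c) = 2 := by
    simp [norm, toWord_mul]
  rw [h2, _root_.map_mul, transvection_of_self, transvection_of_ne _ hac.symm] at h1
  simp only [_root_.map_mul, hs, hb, hc, Bool.eq_false_of_not_eq_true ha, mk_false, _root_.map_inv,
    transvection_symm_of_self, transvection_symm_of_ne hab hab.symm,
    transvection_symm_of_ne hab hac.symm, mul_inv_rev, inv_inv] at h1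
  rw [← mk_false, ← mk_false, ← mk_false, ← mk_true, mul_mk, mul_mk, mul_mk] at h1
  have := h1.length_le (by
    simp [IsCyclicallyReduced, IsReduced, hab, hab.symm, hbc, hbc.symm])
  simp at this

theorem NonExpanding.exists_conj [Fintype α] (hcard : 2 < Fintype.card α)
    {η : FreeGroup α ≃* FreeGroup α} (h : NonExpanding η) :
    ∃ u : FreeGroup α, ∀ g, η g = u⁻¹ * g * u := by
  have : Nontrivial α := Fintype.one_lt_card_iff_nontrivial.1 (by omega)
  obtain ⟨u, hu⟩ := h.exists_conj_letter
  choose s hs using hu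
  have h1 := h.conj u
  have h2 : ∀ a, (η.trans (MulAut.conj u)) (of a) = of a := by
    intro a
    obtain ⟨b, hb⟩ := exists_ne a
    obtain ⟨c, -, hc⟩ := Finset.exists_mem_notMem_of_card_lt_card
      (s := {a, b}) (t := Finset.univ) (Finset.card_le_two.trans_lt (by simpa using hcard))
    simp only [Finset.mem_insert, Finset.mem_singleton, not_or] at hc
    exact h1.eq_of_of_forall_letter (s := s) (by simpa using hs) hb.symm (Ne.symm hc.1)
      (Ne.symm hc.2)
  have h3 : (η.trans (MulAut.conj u)).toMonoidHom = MonoidHom.id _ := by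
    ext a
    simpa using h2 a
  refine ⟨u, fun g => ?_⟩
  have := DFunLike.congr_fun h3 g
  simp only [MulEquiv.toMonoidHom_eq_coe, MonoidHom.coe_coe, MulEquiv.trans_apply,
    MulAut.conj_apply, MonoidHom.id_apply] at this
  conv_rhs => rw [← this]
  group

/-- The length of the longest common prefix of two lists. -/
def commonPrefixLength {β : Type*} [DecidableEq β] : List β → List β → ℕ
  | x :: L, y :: M => if x = y then commonPrefixLength L M + 1 else 0
  | _, _ => 0

theorem min_commonPrefixLength_le {β : Type*} [DecidableEq β] (L M N : List β) :
    min (commonPrefixLength L M) (commonPrefixLength M N) ≤ commonPrefixLength L N := by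
  induction L generalizing M N with
  | nil => simp [commonPrefixLength]
  | cons x L ih =>
    cases M with
    | nil => simp [commonPrefixLength]
    | cons y M =>
      cases N with
      | nil => simp [commonPrefixLength]
      | cons z N =>
        have := ih M N
        simp only [commonPrefixLength]
        split_ifs <;> simp_all

theorem IsReduced.length_reduce_invRev_append {L M : List (α × Bool)} (hL : IsReduced L)
    (hM : IsReduced M) :
    (reduce (FreeGroup.invRev L ++ M)).length + 2 * commonPrefixLength L M =
      L.length + M.length := by
  induction L generalizing M with
  | nil => simp [commonPrefixLength, hM.reduce_eq]
  | cons x L ih =>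
    cases M with
    | nil => simp only [List.append_nil, hL.invRev.reduce_eq, commonPrefixLength,
        invRev_length, List.length_nil]
    | cons y M =>
      by_cases hxy : x = y
      · subst hxy
        have h1 := ih (hL.infix ⟨[x], [], by simp⟩) (M := M) (hM.infix ⟨[x], [], by simp⟩)
        have h2 : reduce (FreeGroup.invRev (x :: L) ++ x :: M) =
            reduce (FreeGroup.invRev L ++ M) := by
          apply reduce.sound
          rw [← mul_mk, ← inv_mk, ← mul_mk, ← inv_mk, ← List.singleton_append, ← mul_mk,
            ← List.singleton_append (l := M), ← mul_mk]
          group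
        rw [h2]
        simp only [commonPrefixLength, if_true, List.length_cons]
        omega
      · have h1 : IsReduced (FreeGroup.invRev (x :: L) ++ y :: M) := by
          have hr := hL.invRev
          simp only [IsReduced, List.isChain_append] at hr hM ⊢
          refine ⟨hr, hM, ?_⟩
          obtain ⟨x1, x2⟩ := x
          obtain ⟨y1, y2⟩ := y
          simp only [FreeGroup.invRev, List.map_cons, List.reverse_cons, List.getLast?_concat,
            List.head?_cons, Option.mem_def, Option.some.injEq]
          rintro _ rfl _ rfl h
          dsimp only at h ⊢
          subst h
          cases x2 <;> cases y2 <;> simp_all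
        rw [h1.reduce_eq]
        simp [commonPrefixLength, hxy]

theorem norm_inv_mul_add (g h : FreeGroup α) :
    norm (g⁻¹ * h) + 2 * commonPrefixLength g.toWord h.toWord = norm g + norm h := by
  rw [norm, toWord_mul, toWord_inv]
  exact isReduced_toWord.length_reduce_invRev_append isReduced_toWord

theorem norm_list_prod_le (w : List (FreeGroup α)) (hw : ∀ x ∈ w, norm x ≤ 1) :
    norm w.prod ≤ w.length := by
  induction w with
  | nil => simp
  | cons x w ih =>
    rw [List.prod_cons, List.length_cons]
    have h1 := norm_mul_le x w.prod
    have h2 := ih fun y hy => hw y (List.mem_cons_of_mem _ hy)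
    have h3 := hw x List.mem_cons_self
    omega

theorem wordLength_basis (ψ : FreeGroup α ≃* FreeGroup α) (g : FreeGroup α) :
    wordLength (Set.range fun a => ψ (of a)) g = norm (ψ.symm g) := by
  have hmem : norm (ψ.symm g) ∈ {n : ℕ | ∃ w : List (FreeGroup α), w.length = n ∧
      (∀ x ∈ w, x ∈ Set.range (fun a => ψ (of a)) ∨ x⁻¹ ∈ Set.range (fun a => ψ (of a))) ∧
      w.prod = g} := by
    refine ⟨(ψ.symm g).toWord.map fun x => ψ (mk [x]), by simp [norm], ?_, ?_⟩
    · simp only [List.mem_map]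
      rintro _ ⟨⟨a, s⟩, -, rfl⟩
      cases s
      · right; exact ⟨a, by simp [mk_false]⟩
      · left; exact ⟨a, by simp [mk_true]⟩
    · have key : ∀ L : List (α × Bool), (L.map fun x => ψ (mk [x])).prod = ψ (mk L) := by
        intro L
        induction L with
        | nil => simp [← one_eq_mk]
        | cons x L ih =>
          rw [List.map_cons, List.prod_cons, ih, ← _root_.map_mul, mul_mk, List.singleton_append]
      rw [key, mk_toWord, MulEquiv.apply_symm_apply]
  refine le_antisymm (Nat.sInf_le hmem) (le_csInf ⟨_, hmem⟩ ?_)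
  rintro n ⟨w, rfl, hw, rfl⟩
  rw [map_list_prod, ← List.length_map (f := ψ.symm)]
  refine norm_list_prod_le _ fun x hx => ?_
  obtain ⟨y, hy, rfl⟩ := List.mem_map.1 hx
  rcases hw y hy with ⟨a, ha⟩ | ⟨a, ha⟩
  · simp [← ha]
  · rw [← norm_inv_eq, ← _root_.map_inv, ← ha]
    simp

theorem gromov_basis (ψ : FreeGroup α ≃* FreeGroup α) (g h : FreeGroup α) :
    gromov (wordDist (Set.range fun a => ψ (of a))) 1 g h =
      commonPrefixLength (ψ.symm g).toWord (ψ.symm h).toWord := by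
  have := norm_inv_mul_add (ψ.symm g) (ψ.symm h)
  simp only [gromov, wordDist, wordLength_basis, inv_one, one_mul, _root_.map_mul, _root_.map_inv]
  have h2 : (norm (ψ.symm g) : ℝ) + norm (ψ.symm h) =
      norm ((ψ.symm g)⁻¹ * ψ.symm h) +
        2 * commonPrefixLength (ψ.symm g).toWord (ψ.symm h).toWord := by
    exact_mod_cast this.symm
  linarith

theorem inVisual_visualRhoOf (ψ : FreeGroup α ≃* FreeGroup α) :
    InVisual (Set.range fun a => ψ (of a)) 1 1 1
      (visualRhoOf (wordDist (Set.range fun a => ψ (of a))) 1 1) := by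
  refine ⟨⟨fun x => by simp [visualRhoOf], fun x y h => ?_, fun x y => ?_, fun x y z => ?_⟩,
    fun g h _ => by simp⟩
  · by_contra hne
    simp [visualRhoOf, hne] at h
  · have h1 : commonPrefixLength (ψ.symm x).toWord (ψ.symm y).toWord =
        commonPrefixLength (ψ.symm y).toWord (ψ.symm x).toWord := by
      have h2 := norm_inv_mul_add (ψ.symm x) (ψ.symm y)
      have h3 := norm_inv_mul_add (ψ.symm y) (ψ.symm x)
      rw [← norm_inv_eq, mul_inv_rev, inv_inv] at h2
      omega
    simp only [visualRhoOf, gromov_basis, h1, eq_comm]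
  · by_cases hxy : x = y
    · subst hxy; simp [visualRhoOf]
    by_cases hyz : y = z
    · subst hyz; simp [visualRhoOf]
    by_cases hxz : x = z
    · subst hxz
      simp only [visualRhoOf, hxy, hyz, if_true, if_false]
      positivity
    simp only [visualRhoOf, hxy, hyz, hxz, if_false, gromov_basis]
    rcases min_le_iff.1 (min_commonPrefixLength_le (ψ.symm x).toWord (ψ.symm y).toWord
      (ψ.symm z).toWord) with h | h
    · refine le_add_of_le_of_nonneg (Real.exp_le_exp.2 ?_) (Real.exp_pos _).le
      have : (commonPrefixLength (ψ.symm x).toWord (ψ.symm y).toWord : ℝ) ≤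
        commonPrefixLength (ψ.symm x).toWord (ψ.symm z).toWord := by exact_mod_cast h
      linarith
    · refine le_add_of_nonneg_of_le (Real.exp_pos _).le (Real.exp_le_exp.2 ?_)
      have : (commonPrefixLength (ψ.symm y).toWord (ψ.symm z).toWord : ℝ) ≤
        commonPrefixLength (ψ.symm x).toWord (ψ.symm z).toWord := by exact_mod_cast h
      linarith

theorem norm_le_of_lipschitz [Nonempty α] (φ ψ : FreeGroup α ≃* FreeGroup α)
    (h : LipschitzCond (visualRhoOf (wordDist (Set.range fun a => ψ (of a))) 1 1)
      (visualRhoOf (wordDist (Set.range fun a => ψ (of a))) 1 1) φ) :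
    ∃ C : ℕ, ∀ g, norm (ψ.symm g) ≤ norm (ψ.symm (φ g)) + C := by
  obtain ⟨K, hK, hφ⟩ := h
  obtain ⟨a⟩ := ‹Nonempty α›
  refine ⟨⌈Real.log K⌉₊ + 1, fun g => ?_⟩
  set k := g * ψ (of a) with hk
  have hne : g ≠ k := by simp [hk, of_ne_one]
  have hne' : φ g ≠ φ k := fun e => hne (φ.injective e)
  have h1 := hφ g k
  simp only [visualRhoOf, hne, hne', if_false] at h1
  rw [← Real.exp_log hK, ← Real.exp_add, Real.exp_le_exp, gromov_basis, gromov_basis] at h1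
  have h2 := norm_inv_mul_add (ψ.symm g) (ψ.symm k)
  have h3 := norm_inv_mul_add (ψ.symm (φ g)) (ψ.symm (φ k))
  have h4 : norm ((ψ.symm g)⁻¹ * ψ.symm k) = 1 := by simp [hk]
  have h5 : norm (ψ.symm (φ k)) ≤ norm (ψ.symm (φ g)) +
      norm ((ψ.symm (φ g))⁻¹ * ψ.symm (φ k)) := by
    simpa using norm_mul_le (ψ.symm (φ g)) ((ψ.symm (φ g))⁻¹ * ψ.symm (φ k))
  have h6 : norm (ψ.symm g) ≤ norm (ψ.symm k) + norm ((ψ.symm g)⁻¹ * ψ.symm k) := by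
    have := norm_mul_le (ψ.symm k) ((ψ.symm g)⁻¹ * ψ.symm k)⁻¹
    rw [norm_inv_eq] at this
    simpa using this
  have h7 := Nat.le_ceil (Real.log K)
  have h8 : commonPrefixLength (ψ.symm g).toWord (ψ.symm k).toWord ≤
      commonPrefixLength (ψ.symm (φ g)).toWord (ψ.symm (φ k)).toWord + ⌈Real.log K⌉₊ := by
    have : (commonPrefixLength (ψ.symm g).toWord (ψ.symm k).toWord : ℝ) ≤
      commonPrefixLength (ψ.symm (φ g)).toWord (ψ.symm (φ k)).toWord + ⌈Real.log K⌉₊ := by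
      linarith
    exact_mod_cast this
  omega

theorem norm_pow_le_s17 (g : FreeGroup α) (n : ℕ) : norm (g ^ n) ≤ n * norm g := by
  induction n with
  | zero => simp
  | succ n ih =>
    rw [pow_succ, add_mul, one_mul]
    exact (norm_mul_le _ _).trans (by omega)

theorem nonExpanding_symm [Nonempty α] (φ : FreeGroup α ≃* FreeGroup α)
    (h : ∀ ψ : FreeGroup α ≃* FreeGroup α,
      LipschitzCond (visualRhoOf (wordDist (Set.range fun a => ψ (of a))) 1 1)
        (visualRhoOf (wordDist (Set.range fun a => ψ (of a))) 1 1) φ) :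
    NonExpanding φ.symm := by
  intro ψ g
  obtain ⟨C, hC⟩ := norm_le_of_lipschitz φ ψ (h ψ)
  refine ⟨C, fun n => ?_⟩
  have h1 := hC (φ.symm (ψ (g ^ n)))
  rw [MulEquiv.apply_symm_apply, MulEquiv.symm_apply_apply, map_pow, map_pow, map_pow] at h1
  have h2 := norm_pow_le_s17 g n
  omega

theorem lipschitzCond_conj {ψ : FreeGroup α ≃* FreeGroup α} {p : FreeGroup α} {γ T : ℝ}
    (hγ : 0 < γ) (hT : 1 ≤ T) {d : FreeGroup α → FreeGroup α → ℝ}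
    (hd : InVisual (Set.range fun a => ψ (of a)) p γ T d) {φ : FreeGroup α → FreeGroup α}
    {x : FreeGroup α} (hφ : ∀ g, φ g = x⁻¹ * g * x) : LipschitzCond d d φ := by
  obtain ⟨hm, hv⟩ := hd
  have hT0 : 0 < T := by linarith
  set N : FreeGroup α → ℝ := fun g => norm (ψ.symm g) with hN
  have Nmul : ∀ g h, N (g * h) ≤ N g + N h := fun g h => by
    simp only [hN, _root_.map_mul]
    exact_mod_cast norm_mul_le _ _
  have Ninv : ∀ g, N g⁻¹ = N g := fun g => by simp [hN]
  set C : ℝ := 2 * N x + N (p⁻¹ * x * p) with hC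
  have hdist : ∀ g h, wordDist (Set.range fun a => ψ (of a)) g h = N (g⁻¹ * h) := fun g h => by
    simp [wordDist, wordLength_basis, hN]
  have base : ∀ g, N (p⁻¹ * g) ≤ N (p⁻¹ * φ g) + N x + N (p⁻¹ * x * p) := fun g => by
    have h1 := Nmul (p⁻¹ * x * p) (p⁻¹ * φ g * x⁻¹)
    have h2 := Nmul (p⁻¹ * φ g) x⁻¹
    have h3 : p⁻¹ * x * p * (p⁻¹ * φ g * x⁻¹) = p⁻¹ * g := by rw [hφ]; group
    rw [h3] at h1
    rw [Ninv] at h2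
    linarith
  have diff : ∀ g h, N ((φ g)⁻¹ * φ h) ≤ N (g⁻¹ * h) + 2 * N x := fun g h => by
    have h1 := Nmul x⁻¹ (g⁻¹ * h * x)
    have h2 := Nmul (g⁻¹ * h) x
    have h3 : x⁻¹ * (g⁻¹ * h * x) = (φ g)⁻¹ * φ h := by rw [hφ, hφ]; group
    rw [h3, Ninv] at h1
    linarith
  have hgr : ∀ g h, gromov (wordDist (Set.range fun a => ψ (of a))) p g h - C ≤
      gromov (wordDist (Set.range fun a => ψ (of a))) p (φ g) (φ h) := fun g h => by
    simp only [gromov, hdist]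
    have := base g
    have := base h
    have := diff g h
    linarith
  refine ⟨T * T * Real.exp (γ * C), by positivity, fun g h => ?_⟩
  by_cases hgh : g = h
  · simp [hgh, hm.refl]
  have hne : φ g ≠ φ h := fun e => hgh (by simpa [hφ] using e)
  have h1 := (hv _ _ hne).2
  have h2 := (hv _ _ hgh).1
  simp only [visualRhoOf, hgh, hne, if_false] at h1 h2
  rw [div_le_iff₀ hT0] at h2
  calc d (φ g) (φ h) ≤ T * Real.exp (-γ * gromov _ p (φ g) (φ h)) := h1
    _ ≤ T * (Real.exp (γ * C) * Real.exp (-γ * gromov _ p g h)) := by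
        rw [← Real.exp_add]
        gcongr
        nlinarith [hgr g h]
    _ ≤ T * (Real.exp (γ * C) * (d g h * T)) := by gcongr
    _ = T * T * Real.exp (γ * C) * d g h := by ring

end FreeGroup

/-- For a free group of rank `> 2`, an automorphism satisfies a
Lipschitz condition with respect to every visual metric taken over a *basis* of the free
group iff it is inner. (A basis is the image of the standard basis under an
automorphism.) -/
theorem stmt_17 {α : Type*} [Fintype α] [DecidableEq α]
    (hcard : 2 < Fintype.card α)
    (φ : FreeGroup α ≃* FreeGroup α) :
    (∀ A' : Set (FreeGroup α),
      (∃ ψ : FreeGroup α ≃* FreeGroup α, A' = Set.range fun a : α => ψ (FreeGroup.of a)) →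
      ∀ (p : FreeGroup α) (γ T : ℝ), 0 < γ → 1 ≤ T →
        ∀ d : FreeGroup α → FreeGroup α → ℝ, InVisual A' p γ T d →
          LipschitzCond d d ⇑φ) ↔
      ∃ x : FreeGroup α, ∀ g : FreeGroup α, φ g = x⁻¹ * g * x := by
  constructor
  · intro h
    have : Nonempty α := Fintype.card_pos_iff.1 (by omega)
    obtain ⟨u, hu⟩ := FreeGroup.NonExpanding.exists_conj hcard
      (FreeGroup.nonExpanding_symm φ fun ψ =>
        h _ ⟨ψ, rfl⟩ 1 1 1 one_pos le_rfl _ (FreeGroup.inVisual_visualRhoOf ψ))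
    refine ⟨u⁻¹, fun g => ?_⟩
    rw [← φ.symm.injective.eq_iff, MulEquiv.symm_apply_apply, hu]
    group
  · rintro ⟨x, hx⟩ _ ⟨ψ, rfl⟩ p γ T hγ hT d hd
    exact FreeGroup.lipschitzCond_conj hγ hT hd hx
end
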